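/- There exists an NDPM M (with 4 pointers) and a pseudo-configuration c of M such that for every m ≥ 1 and every adjacency function a : {1,…,m} × {1,…,m} → {0,1}, letting w(a) be the word over {0,1} encoding the directed graph a, the computation M_c(w(a)) accepts if and only if there is no directed path from vertex 1 to vertex m in the graph a, and M_c(w(a)) rejects otherwise. (In other words, the complement of graph reachability, REACHABILITY-Comp, is decided by an NDPM.) -/

import Mathlib

/-- A pointer instruction: move one step forward, one step backward, or stay. -/
inductive Move : Type
  | forward
  | backward
  | stay
deriving DecidableEq

/-- A non-deterministic pointer machine (NDPM) with `p` pointers: a finite set `Q` of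
states together with a transition relation from pseudo-configurations (the last values
read by the `p` pointers — `none` denoting `⋆` — and the current state) to either a
tuple of instructions and a new state (`Sum.inl`), or `accept` (`Sum.inr true`) /
`reject` (`Sum.inr false`). -/
structure NDPM (p : ℕ) : Type 1 where
  Q : Type
  finQ : Fintype Q
  trans : ((Fin p → Option Bool) × Q) → (((Fin p → Move) × Q) ⊕ Bool) → Prop

/-- A configuration of an NDPM with `p` pointers and state set `Q`: the `p` pointer
positions, the `p` stored values (`none` = `⋆`), and the current state. -/
structure PConfig (p : ℕ) (Q : Type) : Type where
  pos : Fin p → ℕ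
  val : Fin p → Option Bool
  state : Q

/-- The symbol held at position `pos` of the circular tape `⋆a₁…a_k` for the input
word `w = a₁…a_k` (positions are taken modulo `k+1`; position `0` holds `⋆ = none`). -/
def tapeSym (w : List Bool) (pos : ℕ) : Option Bool :=
  if pos % (w.length + 1) = 0 then none else w[(pos % (w.length + 1)) - 1]?

/-- The new position after applying an instruction, on a circular tape of length `k+1`. -/
def movePos (k : ℕ) (pos : ℕ) : Move → ℕ
  | Move.forward => (pos + 1) % (k + 1)
  | Move.backward => (pos + k) % (k + 1)
  | Move.stay => pos

/-- One (non-terminal) computation step of the machine `M` on input word `w`: some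
transition applies to the pseudo-configuration of `c`, each pointer moves according
to its instruction, and the stored value of each pointer that moved is updated to the
symbol at its new position. -/
def NDPM.Step {p : ℕ} (M : NDPM p) (w : List Bool) (c c' : PConfig p M.Q) : Prop :=
  ∃ (mv : Fin p → Move) (q' : M.Q),
    M.trans (c.val, c.state) (Sum.inl (mv, q')) ∧
    c'.state = q' ∧
    (∀ i, c'.pos i = movePos w.length (c.pos i) (mv i)) ∧
    (∀ i, c'.val i =
      if mv i = Move.stay then c.val i
      else tapeSym w (movePos w.length (c.pos i) (mv i)))

/-- The initial configuration of `M_c(w)`: all pointers at position `0`, stored values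
and state given by the pseudo-configuration `c`. -/
def NDPM.initConfig {p : ℕ} (M : NDPM p) (c : (Fin p → Option Bool) × M.Q) :
    PConfig p M.Q :=
  ⟨fun _ => 0, c.1, c.2⟩

/-- `M_c(w)` has an infinite branch: an infinite sequence of configurations starting at
the initial configuration, each related to the next by a computation step. -/
def NDPM.InfiniteBranch {p : ℕ} (M : NDPM p) (c : (Fin p → Option Bool) × M.Q)
    (w : List Bool) : Prop :=
  ∃ f : ℕ → PConfig p M.Q, f 0 = M.initConfig c ∧ ∀ n, M.Step w (f n) (f (n + 1))

/-- `M_c(w)` rejects: some branch reaches a configuration from which a transition to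
`reject` applies. -/
def NDPM.Rejects {p : ℕ} (M : NDPM p) (c : (Fin p → Option Bool) × M.Q)
    (w : List Bool) : Prop :=
  ∃ d : PConfig p M.Q, Relation.ReflTransGen (M.Step w) (M.initConfig c) d ∧
    M.trans (d.val, d.state) (Sum.inr false)

/-- `M_c(w)` accepts: every maximal branch is finite and ends in `accept`, i.e. there
is no infinite branch and no branch ever reaches a transition to `reject` (recall that
a branch to which no transition applies ends in `accept` by default). -/
def NDPM.Accepts {p : ℕ} (M : NDPM p) (c : (Fin p → Option Bool) × M.Q)
    (w : List Bool) : Prop :=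
  ¬ M.InfiniteBranch c w ∧ ¬ M.Rejects c w

/-- `M` decides the set `S` of binary words: for some pseudo-configuration `c`,
`M_c(w)` accepts exactly the words `w ∈ S`. -/
def NDPM.Decides {p : ℕ} (M : NDPM p) (S : Set (List Bool)) : Prop :=
  ∃ c : (Fin p → Option Bool) × M.Q, ∀ w : List Bool, M.Accepts c w ↔ w ∈ S

/-- `M` is acyclic: for every pseudo-configuration and every input word, every branch
of the computation tree is finite. -/
def NDPM.Acyclic {p : ℕ} (M : NDPM p) : Prop :=
  ∀ (c : (Fin p → Option Bool) × M.Q) (w : List Bool), ¬ M.InfiniteBranch c w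

/-- The encoding of row `i` of the adjacency matrix: `a(i,1) 0 a(i,2) 0 … 0 a(i,m)`
(adjacent entries separated by the bit `0`). -/
def rowEnc (a : ℕ → ℕ → Bool) (m i : ℕ) : List Bool :=
  List.intersperse false ((List.range m).map fun j => a i (j + 1))

/-- The encoding `w(a)` of a directed graph on vertices `1,…,m` with adjacency `a`:
`m` zeros (the number of vertices in unary), then the bit `1`, then the rows of the
adjacency matrix, each followed by the separating bit `1`. -/
def graphEnc (a : ℕ → ℕ → Bool) (m : ℕ) : List Bool :=
  List.replicate m false ++ [true] ++
    (List.range m).flatMap fun i => rowEnc a m (i + 1) ++ [true]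

/-- There is a directed path from vertex `1` to vertex `m` in the graph on vertices
`1,…,m` with adjacency `a`. -/
def HasPath (a : ℕ → ℕ → Bool) (m : ℕ) : Prop :=
  ∃ (t : ℕ) (v : ℕ → ℕ), v 0 = 1 ∧ v t = m ∧
    (∀ s ≤ t, 1 ≤ v s ∧ v s ≤ m) ∧
    ∀ s < t, a (v s) (v (s + 1)) = true


/-! ### The tape contents -/

theorem inter_even (l : List Bool) (t : Bool) (s : ℕ) (h : s < l.length) :
    (List.intersperse false l ++ [t])[2 * s]? = l[s]? ∧
    (List.intersperse false l ++ [t])[2 * s + 1]? =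
      some (if s + 1 = l.length then t else false) := by
  induction l generalizing s with
  | nil => simp at h
  | cons x l ih =>
    cases l with
    | nil =>
      have : s = 0 := by simpa using h
      subst this
      simp
    | cons y l =>
      cases s with
      | zero => simp
      | succ s =>
        have := ih s (by simpa using h)
        simpa [Nat.mul_add] using this

theorem inter_length (l : List Bool) (t : Bool) (h : l ≠ []) :
    (List.intersperse false l ++ [t]).length = 2 * l.length := by
  induction l with
  | nil => simp at h
  | cons x l ih =>
    cases l with
    | nil => simp
    | cons y l =>
      have := ih (by simp)
      simp at this ⊢
      omega

theorem flat_length (f : ℕ → List Bool) (L n : ℕ) (h : ∀ i, (f i).length = L) :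
    ((List.range n).flatMap f).length = n * L := by
  induction n with
  | zero => simp
  | succ n ih => simp [List.range_succ, List.flatMap_append, ih, h]; ring

theorem flat_get (f : ℕ → List Bool) (L n : ℕ) (h : ∀ i, (f i).length = L)
    (i r : ℕ) (hi : i < n) (hr : r < L) :
    ((List.range n).flatMap f)[L * i + r]? = (f i)[r]? := by
  induction n with
  | zero => omega
  | succ n ih =>
    have hl := flat_length f L n h
    rw [List.range_succ, List.flatMap_append]
    rcases Nat.lt_succ_iff_lt_or_eq.mp hi with hlt | rfl
    · rw [List.getElem?_append_left]
      · exact ih hlt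
      · rw [hl]; nlinarith
    · rw [List.getElem?_append_right]
      · rw [hl, mul_comm i L]; simp
      · rw [hl]; nlinarith

theorem row_length (a : ℕ → ℕ → Bool) (m i : ℕ) (hm : 1 ≤ m) :
    (rowEnc a m i ++ [true]).length = 2 * m := by
  unfold rowEnc
  rw [inter_length]
  · simp
  · simp; omega

theorem enc_length (a : ℕ → ℕ → Bool) (m : ℕ) (hm : 1 ≤ m) :
    (graphEnc a m).length = m + 1 + 2 * (m * m) := by
  unfold graphEnc
  rw [List.length_append, flat_length _ (2 * m) m (fun i => row_length a m (i+1) hm)]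
  simp; ring

theorem tape_zero (w : List Bool) : tapeSym w 0 = none := by simp [tapeSym]

theorem tape_succ (w : List Bool) (n : ℕ) (h : n < w.length) :
    tapeSym w (n + 1) = w[n]? := by
  unfold tapeSym
  rw [Nat.mod_eq_of_lt (by omega), if_neg (by omega), Nat.add_sub_cancel]

theorem tape_unary (a : ℕ → ℕ → Bool) (m : ℕ) (hm : 1 ≤ m) (n : ℕ) (h1 : 1 ≤ n) (h : n ≤ m) :
    tapeSym (graphEnc a m) n = some false := by
  obtain ⟨n, rfl⟩ : ∃ k, n = k + 1 := ⟨n - 1, by omega⟩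
  rw [tape_succ _ _ (by rw [enc_length a m hm]; omega)]
  unfold graphEnc
  rw [List.append_assoc, List.getElem?_append_left (by simp; omega),
    List.getElem?_replicate, if_pos (by omega)]

theorem tape_sep (a : ℕ → ℕ → Bool) (m : ℕ) (hm : 1 ≤ m) :
    tapeSym (graphEnc a m) (m + 1) = some true := by
  rw [tape_succ _ _ (by rw [enc_length a m hm]; omega)]
  unfold graphEnc
  rw [List.getElem?_append_left (by simp), List.getElem?_append_right (by simp)]
  simp

theorem idx_bound {m r s : ℕ} (hr : r < m) (hs : s < m) : m * r + s + 1 ≤ m * m := by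
  have : m * (r + 1) ≤ m * m := Nat.mul_le_mul_left m hr
  rw [Nat.mul_add] at this
  omega

theorem tape_entry (a : ℕ → ℕ → Bool) (m r s : ℕ) (hr : r < m) (hs : s < m) :
    tapeSym (graphEnc a m) (m + 2 + 2 * (m * r + s)) = some (a (r + 1) (s + 1)) ∧
    tapeSym (graphEnc a m) (m + 3 + 2 * (m * r + s)) = some (decide (s + 1 = m)) := by
  have hm : 1 ≤ m := by omega
  have hb := idx_bound hr hs
  have hin := inter_even ((List.range m).map fun j => a (r + 1) (j + 1)) true s (by simpa using hs)
  have key : ∀ x, x < 2 * m →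
      (graphEnc a m)[m + 1 + (2 * m * r + x)]? = (rowEnc a m (r + 1) ++ [true])[x]? := by
    intro x hx
    unfold graphEnc
    rw [List.getElem?_append_right (by simp)]
    rw [← flat_get (fun i => rowEnc a m (i + 1) ++ [true]) (2 * m) m
      (fun i => row_length a m (i+1) hm) r x hr hx]
    congr 1
    simp
  have e : 2 * m * r = 2 * (m * r) := by ring
  constructor
  · rw [show m + 2 + 2 * (m * r + s) = m + 1 + (2 * m * r + 2 * s) + 1 by rw [e]; omega,
      tape_succ _ _ (by rw [enc_length a m hm, e]; omega), key _ (by omega)]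
    unfold rowEnc
    rw [hin.1]
    simp [hs]
  · rw [show m + 3 + 2 * (m * r + s) = m + 1 + (2 * m * r + (2 * s + 1)) + 1 by rw [e]; omega,
      tape_succ _ _ (by rw [enc_length a m hm, e]; omega), key _ (by omega)]
    unfold rowEnc
    rw [hin.2]
    simp only [List.length_map, List.length_range]
    split_ifs with h <;> simp [h]

theorem tape_some (w : List Bool) (n : ℕ) (h1 : 1 ≤ n) (h : n ≤ w.length) :
    ∃ x, tapeSym w n = some x := by
  obtain ⟨n, rfl⟩ : ∃ k, n = k + 1 := ⟨n - 1, by omega⟩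
  rw [tape_succ _ _ (by omega)]
  exact ⟨_, List.getElem?_eq_getElem (by omega)⟩

theorem fwd_lt {k x : ℕ} (h : x < k) : movePos k x Move.forward = x + 1 := by
  simp only [movePos]; exact Nat.mod_eq_of_lt (by omega)

theorem bwd_pos {k x : ℕ} (h0 : 1 ≤ x) (h : x ≤ k) : movePos k x Move.backward = x - 1 := by
  simp only [movePos]
  rw [show x + k = (x - 1) + (k + 1) by omega, Nat.add_mod_right]
  exact Nat.mod_eq_of_lt (by omega)

theorem movePos_le {k x : ℕ} (h : x ≤ k) (mv : Move) : movePos k x mv ≤ k := by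
  cases mv <;> simp only [movePos]
  · exact Nat.lt_succ_iff.mp (Nat.mod_lt _ (by omega))
  · exact Nat.lt_succ_iff.mp (Nat.mod_lt _ (by omega))
  · exact h

/-! ### The machine -/

/-- States of the machine. -/
inductive RSt : Type
  | qi | qj | qk | q0 | q1 | q2 | q3 | qs | q4 | q5

open RSt in
/-- Transition table; the fourth pointer never moves. -/
inductive RNext : Option Bool → Option Bool → Option Bool → RSt → Move → Move → Move → RSt → Prop
  | start (x y z) : RNext x y z qi .stay .forward .forward qj
  | jk (x y z) : RNext x y (some z) qj .stay .forward .stay qk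
  | k0 (x z) : RNext x (some false) z qk .stay .backward .stay q0
  | rew (x y z) : RNext (some x) y z q0 .forward .stay .stay q0
  | rew0 (y z) : RNext none y z q0 .forward .stay .stay q1
  | f1 (y z) : RNext (some false) y z q1 .forward .stay .stay q1
  | f2 (y z) : RNext (some true) y z q1 .stay .backward .stay q2
  | s1 (x y z) : RNext x (some y) z q2 .forward .stay .stay q3
  | s0 (x z) : RNext x none z q2 .forward .forward .stay q4
  | s3 (x y z) : RNext x y z q3 .forward .stay .stay qs
  | s4 (y z) : RNext (some false) y z qs .forward .stay .stay q3
  | s5 (y z) : RNext (some true) y z qs .stay .backward .stay q2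
  | t1 (x y z) : RNext x y z q4 .forward .stay .stay q5
  | t2 (y z) : RNext (some true) y z q4 .stay .stay .forward qj
  | t3 (y z) : RNext (some false) y z q5 .forward .forward .stay q4

instance : Fintype RSt where
  elems := ⟨([.qi, .qj, .qk, .q0, .q1, .q2, .q3, .qs, .q4, .q5] : List RSt), by simp⟩
  complete := by intro x; cases x <;> simp

/-- The machine. -/
def RM : NDPM 4 where
  Q := RSt
  finQ := inferInstance
  trans := fun c o => match o with
    | Sum.inl (mv, q') =>
        mv 3 = Move.stay ∧ RNext (c.1 0) (c.1 1) (c.1 2) c.2 (mv 0) (mv 1) (mv 2) q'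
    | Sum.inr b => b = false ∧ c.2 = RSt.qk ∧ c.1 1 = some true

/-- Abstract configuration: state and the positions of the first three pointers. -/
structure ACfg where
  q : RSt
  A : ℕ
  B : ℕ
  C : ℕ

/-- Abstract steps. -/
def AStep (w : List Bool) (s s' : ACfg) : Prop :=
  ∃ mA mB mC, RNext (tapeSym w s.A) (tapeSym w s.B) (tapeSym w s.C) s.q mA mB mC s'.q ∧
    s'.A = movePos w.length s.A mA ∧ s'.B = movePos w.length s.B mB ∧
    s'.C = movePos w.length s.C mC

/-- Abstraction of a configuration. -/
def absC (c : PConfig 4 RM.Q) : ACfg := ⟨c.state, c.pos 0, c.pos 1, c.pos 2⟩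

/-- Stored values agree with the tape. -/
def Coh (w : List Bool) (c : PConfig 4 RM.Q) : Prop :=
  ∀ i, c.val i = tapeSym w (c.pos i)

theorem sim1 {w : List Bool} {c c' : PConfig 4 RM.Q} (hc : Coh w c) (h : RM.Step w c c') :
    Coh w c' ∧ AStep w (absC c) (absC c') := by
  obtain ⟨mv, q', ht, hq, hp, hv⟩ := h
  refine ⟨?_, mv 0, mv 1, mv 2, ?_, hp 0, hp 1, hp 2⟩
  · intro i
    rw [hv i, hp i]
    split_ifs with h
    · rw [h]; exact hc i
    · rfl
  · have := ht.2
    simp only [hc 0, hc 1, hc 2] at this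
    simpa only [absC, hq] using this

theorem sim2 {w : List Bool} {c : PConfig 4 RM.Q} (hc : Coh w c) {s : ACfg}
    (h : AStep w (absC c) s) : ∃ c', RM.Step w c c' ∧ absC c' = s := by
  obtain ⟨mA, mB, mC, hn, hA, hB, hC⟩ := h
  let mv : Fin 4 → Move := ![mA, mB, mC, Move.stay]
  refine ⟨⟨fun i => movePos w.length (c.pos i) (mv i),
    fun i => if mv i = Move.stay then c.val i
      else tapeSym w (movePos w.length (c.pos i) (mv i)), s.q⟩,
    ⟨mv, s.q, ⟨rfl, ?_⟩, rfl, fun _ => rfl, fun _ => rfl⟩, ?_⟩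
  · simp only [hc 0, hc 1, hc 2]
    exact hn
  · cases s
    simp only at hA hB hC
    subst hA hB hC
    rfl

/-- Edges between vertices `1..m`. -/
def Edge (a : ℕ → ℕ → Bool) (m : ℕ) (x y : ℕ) : Prop :=
  (1 ≤ y ∧ y ≤ m) ∧ a x y = true

/-- Invariant, in terms of a predicate `R q C u` on the current vertex `u`. -/
def Shape (k m : ℕ) (R : ℕ → Prop) (S : ℕ → ℕ → Prop) (s : ACfg) : Prop :=
  s.A ≤ k ∧ s.B ≤ k ∧ s.C ≤ k ∧
  match s.q with
  | .qi => s.A = 0 ∧ s.B = 0 ∧ s.C = 0 ∧ R 1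
  | .qj => 1 ≤ s.B ∧ s.B ≤ m ∧ R s.B
  | .qk => 2 ≤ s.B ∧ s.B ≤ m + 1 ∧ R (s.B - 1)
  | .q0 => 1 ≤ s.B ∧ s.B ≤ m ∧ R s.B
  | .q1 => 1 ≤ s.A ∧ s.A ≤ m + 1 ∧ 1 ≤ s.B ∧ s.B ≤ m ∧ R s.B
  | .q2 => ∃ r, s.A = m + 1 + 2 * (m * r) ∧ r + s.B + 1 ≤ m ∧ R (r + s.B + 1)
  | .q3 => ∃ r t, s.A = m + 2 + 2 * (m * r + t) ∧ t < m ∧ 1 ≤ s.B ∧ r + s.B + 1 ≤ m ∧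
      R (r + s.B + 1)
  | .qs => ∃ r t, s.A = m + 3 + 2 * (m * r + t) ∧ t < m ∧ 1 ≤ s.B ∧ r + s.B + 1 ≤ m ∧
      R (r + s.B + 1)
  | .q4 => ∃ r t, s.A = m + 2 + 2 * (m * r + t) ∧ t < m ∧ r < m ∧ s.B = t + 1 ∧
      S (r + 1) (t + 1)
  | .q5 => ∃ r t, s.A = m + 3 + 2 * (m * r + t) ∧ t < m ∧ r < m ∧ s.B = t + 1 ∧
      S (r + 1) (t + 2)

/-- First component of the termination measure. -/
def mu1 (k : ℕ) (s : ACfg) : ℕ := match s.q with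
  | .qi => k + 2
  | .qj => if s.C = 0 then 0 else k + 1 - s.C
  | _ => k + 1 - s.C

/-- Second component of the termination measure. -/
def mu2 (k : ℕ) (s : ACfg) : ℕ := match s.q with
  | .qi => 0
  | .qj => 30 * (k + 2) + 1
  | .qk => 30 * (k + 2)
  | .q0 => 20 * (k + 2) + (if s.A = 0 then 0 else k + 1 - s.A)
  | .q1 => 15 * (k + 2) + (k + 1 - s.A)
  | .q2 => 10 * (k + 2) + 2 * (k + 1 - s.A)
  | .q3 => 10 * (k + 2) + 2 * (k + 1 - s.A)
  | .qs => 10 * (k + 2) + 2 * (k + 1 - s.A) + 1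
  | .q4 => k + 1 - s.A
  | .q5 => k + 1 - s.A

/-- The termination order. -/
def MuLt (k : ℕ) (s' s : ACfg) : Prop :=
  mu1 k s' < mu1 k s ∨ (mu1 k s' = mu1 k s ∧ mu2 k s' < mu2 k s)

theorem muLt_wf (k : ℕ) : WellFounded (MuLt k) := by
  have h := InvImage.wf (fun s : ACfg => (mu1 k s, mu2 k s))
    (WellFounded.prod_lex (wellFounded_lt (α := ℕ)) (wellFounded_lt (α := ℕ)))
  refine Subrelation.wf ?_ h
  intro x y hxy
  rcases hxy with h | ⟨h1, h2⟩
  · exact Prod.Lex.left _ _ h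
  · show Prod.Lex _ _ (_, _) (_, _)
    rw [h1]
    exact Prod.Lex.right _ h2

/-- Soundness invariant: the current vertex is reachable. -/
def Sound (a : ℕ → ℕ → Bool) (m : ℕ) (s : ACfg) : Prop :=
  Shape (m + 1 + 2 * (m * m)) m (Relation.ReflTransGen (Edge a m) 1)
    (fun u _ => Relation.ReflTransGen (Edge a m) 1 u) s

theorem sound_step (a : ℕ → ℕ → Bool) (m : ℕ) (hm : 1 ≤ m) (s s' : ACfg)
    (hs : Sound a m s) (h : AStep (graphEnc a m) s s') :
    Sound a m s' ∧ MuLt (m + 1 + 2 * (m * m)) s' s := by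
  obtain ⟨q, A, B, C⟩ := s
  obtain ⟨q', A', B', C'⟩ := s'
  obtain ⟨mA, mB, mC, hn, hA, hB, hC⟩ := h
  simp only at hn hA hB hC
  have hl := enc_length a m hm
  rw [hl] at hA hB hC
  obtain ⟨bA, bB, bC, hs⟩ := hs
  simp only at bA bB bC
  have bA' := movePos_le bA mA
  have bB' := movePos_le bB mB
  have bC' := movePos_le bC mC
  rw [← hA] at bA'
  rw [← hB] at bB'
  rw [← hC] at bC'
  have hz : ∀ x, tapeSym (graphEnc a m) x = none → x ≤ m + 1 + 2 * (m * m) → x = 0 := by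
    intro x hx hxk
    by_contra h0
    obtain ⟨y, hy⟩ := tape_some (graphEnc a m) x (by omega) (by omega)
    rw [hy] at hx; cases hx
  have hnz : ∀ x y, tapeSym (graphEnc a m) x = some y → x ≠ 0 := by
    rintro x y h rfl
    rw [tape_zero] at h; cases h
  have hmm : m ≤ m * m := Nat.le_mul_of_pos_left m hm
  generalize hvA : tapeSym (graphEnc a m) A = vA at hn
  generalize hvB : tapeSym (graphEnc a m) B = vB at hn
  generalize hvC : tapeSym (graphEnc a m) C = vC at hn
  refine ⟨⟨bA', bB', bC', ?_⟩, ?_⟩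
  · clear bA' bB' bC'
    cases hn <;> simp only at hs ⊢ <;> simp only [movePos] at hA hB hC <;> subst hA hC
    case start =>
      obtain ⟨rfl, rfl, rfl, h⟩ := hs
      rw [Nat.mod_eq_of_lt (by omega)] at hB
      subst hB
      exact ⟨le_refl _, hm, h⟩
    case jk =>
      rw [Nat.mod_eq_of_lt (by omega)] at hB
      subst hB
      exact ⟨by omega, by omega, hs.2.2⟩
    case k0 =>
      have hB2 := bwd_pos (k := m + 1 + 2 * (m * m)) (x := B) (by omega) bB
      simp only [movePos] at hB2
      rw [hB2] at hB
      subst hB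
      refine ⟨by omega, by omega, hs.2.2⟩
    case rew => subst hB; exact hs
    case rew0 =>
      have := hz _ hvA bA
      subst this hB
      rw [Nat.mod_eq_of_lt (by omega)]
      exact ⟨by omega, by omega, hs⟩
    case f1 =>
      have : A ≠ m + 1 := by
        rintro rfl
        rw [tape_sep a m hm] at hvA; cases hvA
      subst hB
      rw [Nat.mod_eq_of_lt (by omega)]
      exact ⟨by omega, by omega, hs.2.2⟩
    case f2 =>
      have : A' = m + 1 := by
        by_contra h
        rw [tape_unary a m hm A' (by omega) (by omega)] at hvA; cases hvA
      have hB2 := bwd_pos (k := m + 1 + 2 * (m * m)) (x := B) (by omega) bB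
      simp only [movePos] at hB2
      rw [hB2] at hB
      subst hB
      refine ⟨0, by simpa using this, by omega, ?_⟩
      rw [show 0 + (B - 1) + 1 = B by omega]
      exact hs.2.2.2.2
    case s1 =>
      obtain ⟨r, hr, h1, h2⟩ := hs
      subst hB
      have := hnz _ _ hvB
      have := idx_bound (m := m) (r := r) (s := 0) (by omega) (by omega)
      rw [Nat.mod_eq_of_lt (by omega)]
      exact ⟨r, 0, by omega, by omega, by omega, h1, h2⟩
    case s0 =>
      obtain ⟨r, hr, h1, h2⟩ := hs
      have := hz _ hvB bB
      subst this
      have := idx_bound (m := m) (r := r) (s := 0) (by omega) (by omega)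
      rw [Nat.mod_eq_of_lt (by omega)] at hB
      rw [Nat.mod_eq_of_lt (by omega)]
      exact ⟨r, 0, by omega, by omega, by omega, hB, h2⟩
    case s3 =>
      obtain ⟨r, t, hr, h1, h2, h3, h4⟩ := hs
      have := idx_bound (m := m) (r := r) (s := t) (by omega) (by omega)
      subst hB
      rw [Nat.mod_eq_of_lt (by omega)]
      exact ⟨r, t, by omega, h1, h2, h3, h4⟩
    case s4 =>
      obtain ⟨r, t, hr, h1, h2, h3, h4⟩ := hs
      have hT := (tape_entry a m r t (by omega) h1).2
      rw [hr, hT] at hvA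
      have ht : t + 1 ≠ m := by simpa using hvA
      have := idx_bound (m := m) (r := r) (s := t + 1) (by omega) (by omega)
      subst hB
      rw [Nat.mod_eq_of_lt (by omega)]
      exact ⟨r, t + 1, by omega, by omega, h2, h3, h4⟩
    case s5 =>
      obtain ⟨r, t, hr, h1, h2, h3, h4⟩ := hs
      have hT := (tape_entry a m r t (by omega) h1).2
      rw [hr, hT] at hvA
      have ht : t + 1 = m := by simpa using hvA
      have hB2 := bwd_pos (k := m + 1 + 2 * (m * m)) (x := B) (by omega) bB
      simp only [movePos] at hB2
      rw [hB2] at hB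
      subst hB
      refine ⟨r + 1, ?_, by omega, ?_⟩
      · rw [Nat.mul_add]; omega
      · rw [show r + 1 + (B - 1) + 1 = r + B + 1 by omega]
        exact h4
    case t1 =>
      obtain ⟨r, t, hr, h1, h2, h3, h4⟩ := hs
      have := idx_bound (m := m) (r := r) (s := t) (by omega) (by omega)
      subst hB
      rw [Nat.mod_eq_of_lt (by omega)]
      exact ⟨r, t, by omega, h1, h2, h3, h4⟩
    case t2 =>
      obtain ⟨r, t, hr, h1, h2, h3, h4⟩ := hs
      have hT := (tape_entry a m r t (by omega) h1).1
      rw [hr, hT] at hvA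
      subst hB
      subst h3
      exact ⟨by omega, by omega, h4.tail ⟨⟨by omega, by omega⟩, by simpa using hvA⟩⟩
    case t3 =>
      obtain ⟨r, t, hr, h1, h2, h3, h4⟩ := hs
      have hT := (tape_entry a m r t (by omega) h1).2
      rw [hr, hT] at hvA
      have ht : t + 1 ≠ m := by simpa using hvA
      have := idx_bound (m := m) (r := r) (s := t + 1) (by omega) (by omega)
      rw [Nat.mod_eq_of_lt (by omega)] at hB
      subst hB
      rw [Nat.mod_eq_of_lt (by omega)]
      exact ⟨r, t + 1, by omega, by omega, h2, by omega, h4⟩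
  · have hf : ∀ x, x ≤ m + 1 + 2 * (m * m) →
        ((x + 1) % (m + 1 + 2 * (m * m) + 1) = x + 1 ∧ x + 1 ≤ m + 1 + 2 * (m * m)) ∨
        ((x + 1) % (m + 1 + 2 * (m * m) + 1) = 0 ∧ x = m + 1 + 2 * (m * m)) := by
      intro x hx
      rcases Nat.lt_or_eq_of_le hx with h | h
      · left; exact ⟨Nat.mod_eq_of_lt (by omega), h⟩
      · right; subst h; simp
    have fA := hf A bA
    have fC := hf C bC
    clear hf
    unfold MuLt
    cases hn <;> simp only at hs ⊢ <;> simp only [movePos] at hA hC <;> subst hA hC <;>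
      simp only [mu1, mu2, true_and]
    case start => left; split_ifs <;> omega
    case jk =>
      have := hnz _ _ hvC
      right; simp [this]
    case k0 => right; split_ifs <;> omega
    case rew =>
      have := hnz _ _ hvA
      right; split_ifs <;> omega
    case rew0 =>
      have := hz _ hvA bA
      right; split_ifs <;> omega
    case f1 => right; omega
    case f2 => right; omega
    case s1 =>
      obtain ⟨r, hr, h1, h2⟩ := hs
      have := idx_bound (m := m) (r := r) (s := 0) (by omega) (by omega)
      right; omega
    case s0 => right; omega
    case s3 =>
      obtain ⟨r, t, hr, h1, h2, h3, h4⟩ := hs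
      have := idx_bound (m := m) (r := r) (s := t) (by omega) (by omega)
      right; omega
    case s4 =>
      obtain ⟨r, t, hr, h1, h2, h3, h4⟩ := hs
      have hT := (tape_entry a m r t (by omega) h1).2
      rw [hr, hT] at hvA
      have ht : t + 1 ≠ m := by simpa using hvA
      have := idx_bound (m := m) (r := r) (s := t + 1) (by omega) (by omega)
      right; omega
    case s5 => right; omega
    case t1 =>
      obtain ⟨r, t, hr, h1, h2, h3, h4⟩ := hs
      have := idx_bound (m := m) (r := r) (s := t) (by omega) (by omega)
      right; omega
    case t2 => left; split_ifs <;> omega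
    case t3 =>
      obtain ⟨r, t, hr, h1, h2, h3, h4⟩ := hs
      have hT := (tape_entry a m r t (by omega) h1).2
      rw [hr, hT] at hvA
      have ht : t + 1 ≠ m := by simpa using hvA
      have := idx_bound (m := m) (r := r) (s := t + 1) (by omega) (by omega)
      right; omega

/-! ### Completeness -/

/-- There is a path with `n` edges from the given vertex to `m`. -/
def DistTo (a : ℕ → ℕ → Bool) (m : ℕ) : ℕ → ℕ → Prop
  | 0, u => u = m
  | n + 1, u => ∃ t, 1 ≤ t ∧ t ≤ m ∧ a u t = true ∧ DistTo a m n t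

/-- Remaining path within the budget of the step counter. -/
def RG (a : ℕ → ℕ → Bool) (m k c lo : ℕ) (u : ℕ) : Prop :=
  ∃ n, lo ≤ n ∧ DistTo a m n u ∧ c + n ≤ k

/-- Remaining path while scanning row `u` from column `j` on. -/
def SG (a : ℕ → ℕ → Bool) (m k c : ℕ) (u j : ℕ) : Prop :=
  ∃ n t, j ≤ t ∧ t ≤ m ∧ a u t = true ∧ DistTo a m n t ∧ c + n + 1 ≤ k

/-- Value of the counter used in the invariant. -/
def ccG (s : ACfg) : ℕ := match s.q with
  | .qi => 1
  | _ => s.C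

/-- Lower bound on the remaining path length. -/
def loG (s : ACfg) : ℕ := match s.q with
  | .qi => 0
  | .qj => 0
  | .qk => 0
  | _ => 1

/-- Configurations from which rejection can be reached. -/
def Good (a : ℕ → ℕ → Bool) (m : ℕ) (s : ACfg) : Prop :=
  (s.q = RSt.qi ∨ 1 ≤ s.C) ∧
  Shape (m + 1 + 2 * (m * m)) m (RG a m (m + 1 + 2 * (m * m)) (ccG s) (loG s))
    (SG a m (m + 1 + 2 * (m * m)) (ccG s)) s

theorem good_step (a : ℕ → ℕ → Bool) (m : ℕ) (hm : 1 ≤ m) (s : ACfg) (hs : Good a m s) :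
    (s.q = RSt.qk ∧ tapeSym (graphEnc a m) s.B = some true) ∨
    ∃ s', AStep (graphEnc a m) s s' ∧ Good a m s' := by
  obtain ⟨q, A, B, C⟩ := s
  have hl := enc_length a m hm
  obtain ⟨hC1, bA, bB, bC, hs⟩ := hs
  simp only at hC1 bA bB bC
  have hmm : m ≤ m * m := Nat.le_mul_of_pos_left m hm
  have hsm := tape_some (graphEnc a m)
  rw [hl] at hsm
  cases q <;> simp only [ccG, loG] at hs
  case qi =>
    obtain ⟨rfl, rfl, rfl, h⟩ := hs
    right
    refine ⟨⟨.qj, 0, 1, 1⟩, ⟨_, _, _, RNext.start _ _ _, rfl, ?_, ?_⟩, Or.inr le_rfl, by simp,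
      by simp only; omega, by simp only; omega, le_rfl, hm, h⟩
    · exact (fwd_lt (by rw [hl]; omega)).symm
    · exact (fwd_lt (by rw [hl]; omega)).symm
  case qj =>
    obtain ⟨h1, h2, h⟩ := hs
    have hC1 : 1 ≤ C := by simpa using hC1
    obtain ⟨z, hz⟩ := hsm C hC1 bC
    right
    refine ⟨⟨.qk, A, B + 1, C⟩, ⟨.stay, .forward, .stay, ?_, rfl, ?_, rfl⟩, Or.inr hC1, bA,
      by simp only; omega, bC, by simp only; omega, by simp only; omega, h⟩
    · simp only [hz]; exact RNext.jk _ _ _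
    · exact (fwd_lt (by rw [hl]; omega)).symm
  case qk =>
    obtain ⟨h1, h2, h⟩ := hs
    have hC1 : 1 ≤ C := by simpa using hC1
    by_cases hB : B = m + 1
    · left
      subst hB
      exact ⟨rfl, tape_sep a m hm⟩
    · right
      obtain ⟨n, -, hn, hn2⟩ := h
      have hn1 : 1 ≤ n := by
        rcases n with _ | n
        · have : B - 1 = m := hn
          omega
        · omega
      refine ⟨⟨.q0, A, B - 1, C⟩, ⟨.stay, .backward, .stay, ?_, rfl, ?_, rfl⟩, Or.inr hC1, bA,
        by simp only; omega, bC, by simp only; omega, by simp only; omega, n, hn1, hn, hn2⟩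
      · simp only [tape_unary a m hm B (by omega) (by omega)]; exact RNext.k0 _ _
      · exact (bwd_pos (by omega) (by rw [hl]; exact bB)).symm
  case q0 =>
    have hC1 : 1 ≤ C := by simpa using hC1
    right
    by_cases hA : A = 0
    · subst hA
      refine ⟨⟨.q1, 1, B, C⟩, ⟨.forward, .stay, .stay, ?_, ?_, rfl, rfl⟩, Or.inr hC1,
        by simp only; omega, bB, bC, by simp only; omega, by simp only; omega, hs⟩
      · simp only [tape_zero]; exact RNext.rew0 _ _
      · exact (fwd_lt (by rw [hl]; omega)).symm
    · obtain ⟨z, hz⟩ := hsm A (by omega) bA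
      refine ⟨⟨.q0, movePos (graphEnc a m).length A .forward, B, C⟩,
        ⟨.forward, .stay, .stay, ?_, rfl, rfl, rfl⟩, Or.inr hC1, ?_, bB, bC, hs⟩
      · simp only [hz]; exact RNext.rew _ _ _
      · rw [hl]; exact movePos_le bA Move.forward
  case q1 =>
    have hC1 : 1 ≤ C := by simpa using hC1
    obtain ⟨h1, h2, h3, h4, h⟩ := hs
    right
    by_cases hA : A = m + 1
    · subst hA
      refine ⟨⟨.q2, m + 1, B - 1, C⟩, ⟨.stay, .backward, .stay, ?_, rfl, ?_, rfl⟩, Or.inr hC1, bA,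
        by simp only; omega, bC, 0, by simp, by simp only; omega, ?_⟩
      · simp only [tape_sep a m hm]; exact RNext.f2 _ _
      · exact (bwd_pos h3 (by rw [hl]; exact bB)).symm
      · simp only
        rw [show 0 + (B - 1) + 1 = B by omega]
        exact h
    · refine ⟨⟨.q1, A + 1, B, C⟩, ⟨.forward, .stay, .stay, ?_, ?_, rfl, rfl⟩, Or.inr hC1,
        by simp only; omega, bB, bC, by simp only; omega, by simp only; omega, h3, h4, h⟩
      · simp only [tape_unary a m hm A h1 (by omega)]; exact RNext.f1 _ _
      · exact (fwd_lt (by rw [hl]; omega)).symm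
  case q2 =>
    have hC1 : 1 ≤ C := by simpa using hC1
    obtain ⟨r, hr, h1, h⟩ := hs
    have hb := idx_bound (m := m) (r := r) (s := 0) (by omega) (by omega)
    right
    by_cases hB : B = 0
    · subst hB
      refine ⟨⟨.q4, A + 1, 1, C⟩, ⟨.forward, .forward, .stay, ?_, ?_, ?_, rfl⟩, Or.inr hC1,
        by simp only; omega, by simp only; omega, bC, r, 0, by simp only; omega, by omega,
        by omega, rfl, ?_⟩
      · simp only [tape_zero]; exact RNext.s0 _ _
      · exact (fwd_lt (by rw [hl]; omega)).symm
      · exact (fwd_lt (by rw [hl]; omega)).symm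
      · obtain ⟨n, hn1, hn, hn2⟩ := h
        obtain ⟨n, rfl⟩ : ∃ k, n = k + 1 := ⟨n - 1, by omega⟩
        obtain ⟨t, ht1, ht2, ht3, ht4⟩ := hn
        exact ⟨n, t, ht1, ht2, ht3, ht4, by simp only [ccG]; omega⟩
    · obtain ⟨z, hz⟩ := hsm B (by omega) bB
      refine ⟨⟨.q3, A + 1, B, C⟩, ⟨.forward, .stay, .stay, ?_, ?_, rfl, rfl⟩, Or.inr hC1,
        by simp only; omega, bB, bC, r, 0, by simp only; omega, by omega, by simp only; omega,
        h1, h⟩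
      · simp only [hz]; exact RNext.s1 _ _ _
      · exact (fwd_lt (by rw [hl]; omega)).symm
  case q3 =>
    have hC1 : 1 ≤ C := by simpa using hC1
    obtain ⟨r, t, hr, h1, h2, h3, h⟩ := hs
    have hb := idx_bound (m := m) (r := r) (s := t) (by omega) (by omega)
    right
    refine ⟨⟨.qs, A + 1, B, C⟩, ⟨.forward, .stay, .stay, RNext.s3 _ _ _, ?_, rfl, rfl⟩, Or.inr hC1,
      by simp only; omega, bB, bC, r, t, by simp only; omega, h1, h2, h3, h⟩
    exact (fwd_lt (by rw [hl]; omega)).symm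
  case qs =>
    have hC1 : 1 ≤ C := by simpa using hC1
    obtain ⟨r, t, hr, h1, h2, h3, h⟩ := hs
    have hT := (tape_entry a m r t (by omega) h1).2
    rw [← hr] at hT
    right
    by_cases ht : t + 1 = m
    · refine ⟨⟨.q2, A, B - 1, C⟩, ⟨.stay, .backward, .stay, ?_, rfl, ?_, rfl⟩, Or.inr hC1, bA,
        by simp only; omega, bC, r + 1, ?_, by simp only; omega, ?_⟩
      · simp only [hT, ht, decide_true]; exact RNext.s5 _ _
      · exact (bwd_pos h2 (by rw [hl]; exact bB)).symm
      · simp only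
        rw [Nat.mul_add]; omega
      · simp only
        rw [show r + 1 + (B - 1) + 1 = r + B + 1 by omega]
        exact h
    · have hb := idx_bound (m := m) (r := r) (s := t + 1) (by omega) (by omega)
      refine ⟨⟨.q3, A + 1, B, C⟩, ⟨.forward, .stay, .stay, ?_, ?_, rfl, rfl⟩, Or.inr hC1,
        by simp only; omega, bB, bC, r, t + 1, by simp only; omega, by omega, h2, h3, h⟩
      · simp only [hT, ht, decide_false]; exact RNext.s4 _ _
      · exact (fwd_lt (by rw [hl]; omega)).symm
  case q4 =>
    have hC1 : 1 ≤ C := by simpa using hC1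
    obtain ⟨r, t, hr, h1, h2, h3, h⟩ := hs
    have hT := (tape_entry a m r t (by omega) h1).1
    rw [← hr] at hT
    have hb := idx_bound (m := m) (r := r) (s := t) (by omega) (by omega)
    obtain ⟨n, u, hu1, hu2, hu3, hu4, hu5⟩ := h
    right
    by_cases hu : u = t + 1
    · subst hu
      refine ⟨⟨.qj, A, B, C + 1⟩, ⟨.stay, .stay, .forward, ?_, rfl, rfl, ?_⟩,
        Or.inr (by simp only; omega), bA, bB, by simp only; omega, by simp only; omega,
        by simp only; omega, n, by simp [loG], ?_, by simp only [ccG]; omega⟩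
      · simp only [hT, hu3]; exact RNext.t2 _ _
      · exact (fwd_lt (by rw [hl]; omega)).symm
      · simp only [h3]; exact hu4
    · refine ⟨⟨.q5, A + 1, B, C⟩, ⟨.forward, .stay, .stay, RNext.t1 _ _ _, ?_, rfl, rfl⟩,
        Or.inr hC1, by simp only; omega, bB, bC, r, t, by simp only; omega, h1, h2, h3,
        n, u, by omega, hu2, hu3, hu4, hu5⟩
      exact (fwd_lt (by rw [hl]; omega)).symm
  case q5 =>
    have hC1 : 1 ≤ C := by simpa using hC1
    obtain ⟨r, t, hr, h1, h2, h3, h⟩ := hs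
    have hT := (tape_entry a m r t (by omega) h1).2
    rw [← hr] at hT
    have ht : t + 1 ≠ m := by
      obtain ⟨n, u, hu1, hu2, -⟩ := h
      omega
    have hb := idx_bound (m := m) (r := r) (s := t + 1) (by omega) (by omega)
    right
    refine ⟨⟨.q4, A + 1, B + 1, C⟩, ⟨.forward, .forward, .stay, ?_, ?_, ?_, rfl⟩, Or.inr hC1,
      by simp only; omega, by simp only; omega, bC, r, t + 1, by simp only; omega, by omega, h2,
      by simp only; omega, h⟩
    · simp only [hT, ht, decide_false]; exact RNext.t3 _ _
    · exact (fwd_lt (by rw [hl]; omega)).symm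
    · exact (fwd_lt (by rw [hl]; omega)).symm

/-! ### Paths -/

theorem path_of_reach (a : ℕ → ℕ → Bool) (m : ℕ) (hm : 1 ≤ m) (u : ℕ)
    (h : Relation.ReflTransGen (Edge a m) 1 u) :
    ∃ (t : ℕ) (v : ℕ → ℕ), v 0 = 1 ∧ v t = u ∧ (∀ s ≤ t, 1 ≤ v s ∧ v s ≤ m) ∧
      ∀ s < t, a (v s) (v (s + 1)) = true := by
  induction h with
  | refl => exact ⟨0, fun _ => 1, rfl, rfl, fun _ _ => ⟨le_rfl, hm⟩, fun s hs => by omega⟩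
  | @tail b c _ hbc ih =>
    obtain ⟨t, v, h0, h1, h2, h3⟩ := ih
    refine ⟨t + 1, fun s => if s ≤ t then v s else c, by simp [h0], by simp, ?_, ?_⟩
    · intro s hs
      by_cases h : s ≤ t
      · simpa [h] using h2 s h
      · simpa [h] using hbc.1
    · intro s hs
      by_cases h : s + 1 ≤ t
      · have : s ≤ t := by omega
        simpa [h, this] using h3 s (by omega)
      · have : s = t := by omega
        subst this
        simpa [h1] using hbc.2

theorem dist_of_path (a : ℕ → ℕ → Bool) (m : ℕ) (n : ℕ) : ∀ (v : ℕ → ℕ), v n = m →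
    (∀ s ≤ n, 1 ≤ v s ∧ v s ≤ m) → (∀ s < n, a (v s) (v (s + 1)) = true) →
    DistTo a m n (v 0) := by
  induction n with
  | zero => intro v h _ _; exact h
  | succ n ih =>
    intro v h1 h2 h3
    exact ⟨v 1, (h2 1 (by omega)).1, (h2 1 (by omega)).2, h3 0 (by omega),
      ih (fun s => v (s + 1)) h1 (fun s hs => h2 (s + 1) (by omega))
        (fun s hs => h3 (s + 1) (by omega))⟩

theorem short_path (a : ℕ → ℕ → Bool) (m : ℕ) (h : HasPath a m) :
    ∃ n, n < m ∧ DistTo a m n 1 := by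
  classical
  have hex : ∃ t, ∃ v : ℕ → ℕ, v 0 = 1 ∧ v t = m ∧ (∀ s ≤ t, 1 ≤ v s ∧ v s ≤ m) ∧
      ∀ s < t, a (v s) (v (s + 1)) = true := h
  obtain ⟨v, h0, h1, h2, h3⟩ := Nat.find_spec hex
  have hmin := fun t => Nat.find_min (H := hex) (m := t)
  generalize Nat.find hex = t at *
  refine ⟨t, ?_, h0 ▸ dist_of_path a m t v h1 h2 h3⟩
  have hlt : ∀ x y, x < y → y ≤ t → v x ≠ v y := by
    intro x y hxy hy he
    apply hmin (t - (y - x)) (by omega)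
    refine ⟨fun s => if s ≤ x then v s else v (s + (y - x)), by simp [h0], ?_, ?_, ?_⟩
    · by_cases hx : t - (y - x) ≤ x
      · have e : t - (y - x) = x := by omega
        have e2 : y = t := by omega
        simp only [e, le_refl, if_true]
        rw [he, e2, h1]
      · simp only [hx, if_false]
        rw [Nat.sub_add_cancel (by omega)]
        exact h1
    · intro s hs
      dsimp only
      split_ifs
      · exact h2 s (by omega)
      · exact h2 _ (by omega)
    · intro s hs
      dsimp only
      rcases lt_trichotomy s x with hx | hx | hx
      · rw [if_pos (by omega), if_pos (by omega)]
        exact h3 s (by omega)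
      · subst hx
        rw [if_pos le_rfl, if_neg (by omega), he, show s + 1 + (y - s) = y + 1 by omega]
        exact h3 y (by omega)
      · rw [if_neg (by omega), if_neg (by omega),
          show s + 1 + (y - x) = s + (y - x) + 1 by omega]
        exact h3 _ (by omega)
  have hcard : (Finset.range (t + 1)).card ≤ (Finset.Icc 1 m).card := by
    apply Finset.card_le_card_of_injOn v
    · intro s hs
      have := Finset.mem_coe.mp hs
      rw [Finset.mem_range] at this
      have := h2 s (by omega)
      simpa using this
    · intro x hx y hy he
      have hx := Finset.mem_range.mp (Finset.mem_coe.mp hx)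
      have hy := Finset.mem_range.mp (Finset.mem_coe.mp hy)
      rcases lt_trichotomy x y with h | h | h
      · exact absurd he (hlt x y h (by omega))
      · exact h
      · exact absurd he.symm (hlt y x h (by omega))
  simp at hcard
  omega

theorem good_rejects (a : ℕ → ℕ → Bool) (m : ℕ) (hm : 1 ≤ m) (s : ACfg) :
    ∀ c : PConfig 4 RM.Q, absC c = s → Coh (graphEnc a m) c → Sound a m s → Good a m s →
    ∃ d, Relation.ReflTransGen (RM.Step (graphEnc a m)) c d ∧
      RM.trans (d.val, d.state) (Sum.inr false) := by
  induction s using (muLt_wf (m + 1 + 2 * (m * m))).induction with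
  | _ s ih =>
    intro c hcs hc hS hG
    rcases good_step a m hm s hG with ⟨h1, h2⟩ | ⟨s', hs', hG'⟩
    · subst hcs
      exact ⟨c, .refl, rfl, h1, (hc 1).trans h2⟩
    · subst hcs
      obtain ⟨hS', hlt⟩ := sound_step a m hm _ _ hS hs'
      obtain ⟨c', hst, hc'⟩ := sim2 hc hs'
      obtain ⟨d, hd, hd2⟩ := ih s' hlt c' hc' (sim1 hc hst).1 hS' hG'
      exact ⟨d, .head hst hd, hd2⟩

/-- there is an NDPM with 4 pointers and a pseudo-configuration `c` such
that on the encoding of any directed graph on `m ≥ 1` vertices, the machine accepts iff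
there is no directed path from vertex `1` to vertex `m`, and rejects otherwise:
REACHABILITY-Comp is decided by an NDPM. -/
theorem reachability_comp_NDPM :
    ∃ (M : NDPM 4) (c : (Fin 4 → Option Bool) × M.Q),
      ∀ m : ℕ, 1 ≤ m → ∀ a : ℕ → ℕ → Bool,
        (M.Accepts c (graphEnc a m) ↔ ¬ HasPath a m) ∧
        (M.Rejects c (graphEnc a m) ↔ HasPath a m) := by
  refine ⟨RM, (fun _ => none, RSt.qi), fun m hm a => ?_⟩
  have hcoh : Coh (graphEnc a m) (RM.initConfig (fun _ => none, RSt.qi)) :=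
    fun _ => (tape_zero _).symm
  have hsound : Sound a m (absC (RM.initConfig (fun _ => none, RSt.qi))) :=
    ⟨Nat.zero_le _, Nat.zero_le _, Nat.zero_le _, rfl, rfl, rfl, .refl⟩
  have hrej : RM.Rejects (fun _ => none, RSt.qi) (graphEnc a m) ↔ HasPath a m := by
    constructor
    · rintro ⟨d, hd, -, hq, hB⟩
      have hinv : Coh (graphEnc a m) d ∧ Sound a m (absC d) := by
        clear hq hB
        induction hd with
        | refl => exact ⟨hcoh, hsound⟩
        | tail _ hst ih =>
          have h := sim1 ih.1 hst
          exact ⟨h.1, (sound_step a m hm _ _ ih.2 h.2).1⟩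
      obtain ⟨hc, -, -, -, hS⟩ := hinv
      have hq' : (absC d).q = RSt.qk := hq
      rw [hq'] at hS
      obtain ⟨h1, h2, h3⟩ := hS
      have hB' : tapeSym (graphEnc a m) (absC d).B = some true := (hc 1).symm.trans hB
      have hBm : (absC d).B = m + 1 := by
        by_contra hne
        rw [tape_unary a m hm _ (by omega) (by omega)] at hB'
        cases hB'
      rw [hBm] at h3
      exact path_of_reach a m hm m h3
    · intro hp
      obtain ⟨n, hn, hd⟩ := short_path a m hp
      exact good_rejects a m hm _ _ rfl hcoh hsound
        ⟨Or.inl rfl, Nat.zero_le _, Nat.zero_le _, Nat.zero_le _, rfl, rfl, rfl,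
          n, Nat.zero_le _, hd, by show 1 + n ≤ _; omega⟩
  refine ⟨?_, hrej⟩
  rw [← hrej]
  refine ⟨fun h => h.2, fun h => ⟨?_, h⟩⟩
  rintro ⟨f, hf0, hf⟩
  have hinv : ∀ n, Coh (graphEnc a m) (f n) ∧ Sound a m (absC (f n)) := by
    intro n
    induction n with
    | zero => rw [hf0]; exact ⟨hcoh, hsound⟩
    | succ n ih =>
      have h := sim1 ih.1 (hf n)
      exact ⟨h.1, (sound_step a m hm _ _ ih.2 h.2).1⟩
  have hno := (wellFounded_iff_isEmpty_descending_chain.mp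
    (muLt_wf (m + 1 + 2 * (m * m))))
  exact hno.false ⟨fun n => absC (f n), fun n =>
    (sound_step a m hm _ _ (hinv n).2 (sim1 (hinv n).1 (hf n)).2).2⟩
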